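/- For every integer r ≥ 3 there exists N_0 such that for every integer n ≥ N_0, every collection of n matchings, each of size at least (r+1)n/2 + 3r²·n^{(2r−1)/(2r)}, in an r-uniform hypergraph admits a rainbow matching of size n; equivalently, h'(r,n) ≤ (r+1)n/2 + 3r²·n^{(2r−1)/(2r)} for all sufficiently large n. -/

import Mathlib

/-- `A` is a matching consisting of `r`-element edges: every edge has exactly `r`
vertices and distinct edges are pairwise disjoint. -/
def IsMatching {V : Type*} (r : ℕ) (A : Finset (Finset V)) : Prop :=
  (∀ e ∈ A, e.card = r) ∧ ∀ e ∈ A, ∀ f ∈ A, e ≠ f → Disjoint e f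

/-- The collection of matchings `M 0, …, M (n-1)` admits a rainbow matching of size `s`:
there are `s` pairwise disjoint edges together with an injective assignment of colours
such that each edge lies in the matching of its assigned colour. -/
def HasRainbow {V : Type*} {n : ℕ} (M : Fin n → Finset (Finset V)) (s : ℕ) : Prop :=
  ∃ (c : Fin s → Fin n) (e : Fin s → Finset V),
    Function.Injective c ∧ (∀ j, e j ∈ M (c j)) ∧
      ∀ j k, j ≠ k → Disjoint (e j) (e k)

/-- With respect to the partition of the vertex set given by `P : V → Fin r`,
the edge `e` contains exactly one vertex from each part. -/
def IsPartiteEdge {V : Type*} (r : ℕ) (P : V → Fin r) (e : Finset V) : Prop :=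
  ∀ k : Fin r, (e.filter fun v => P v = k).card = 1

/-- Set-pair inequality: if `A i` and `B i` are disjoint but `A i` meets `B j` whenever
`i ≠ j`, then the number of pairs is bounded in terms of the sizes of the sets. -/
theorem card_le_of_crossIntersecting {V ι : Type*} [DecidableEq V] [DecidableEq ι] (b : ℕ) :
    ∀ (a : ℕ) (C : Finset ι) (A B : ι → Finset V),
      (∀ i ∈ C, (A i).card ≤ a) → (∀ i ∈ C, (B i).card ≤ b) →
      (∀ i ∈ C, Disjoint (A i) (B i)) →
      (∀ i ∈ C, ∀ j ∈ C, i ≠ j → ¬ Disjoint (A i) (B j)) →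
      C.card ≤ (b + 1) ^ a := by
  intro a
  induction a with
  | zero =>
    intro C A B hA _ _ hAB
    simp only [pow_zero]
    refine Finset.card_le_one.2 fun i hi j hj => ?_
    by_contra hij
    have := hA i hi
    simp only [Nat.le_zero, Finset.card_eq_zero] at this
    exact hAB i hi j hj hij (by simp [this])
  | succ a ih =>
    intro C A B hA hB hd hAB
    rcases C.eq_empty_or_nonempty with rfl | ⟨c, hc⟩
    · simp
    have hsub : C.erase c ⊆ (B c).biUnion fun v => C.filter fun i => v ∈ A i := by
      intro i hi
      rw [Finset.mem_erase] at hi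
      obtain ⟨v, hv, hv'⟩ := Finset.not_disjoint_iff.1 (hAB i hi.2 c hc hi.1)
      exact Finset.mem_biUnion.2 ⟨v, hv', Finset.mem_filter.2 ⟨hi.2, hv⟩⟩
    have hpart : ∀ v ∈ B c, (C.filter fun i => v ∈ A i).card ≤ (b + 1) ^ a := by
      intro v _
      refine ih _ (fun i => (A i).erase v) B ?_ ?_ ?_ ?_
      · intro i hi
        rw [Finset.mem_filter] at hi
        have := hA i hi.1
        rw [Finset.card_erase_of_mem hi.2]
        omega
      · exact fun i hi => hB i (Finset.mem_filter.1 hi).1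
      · exact fun i hi => (hd i (Finset.mem_filter.1 hi).1).mono_left (Finset.erase_subset _ _)
      · intro i hi j hj hij h
        rw [Finset.mem_filter] at hi hj
        obtain ⟨w, hw, hw'⟩ := Finset.not_disjoint_iff.1 (hAB i hi.1 j hj.1 hij)
        have hwv : w ≠ v := by
          rintro rfl
          exact Finset.disjoint_left.1 (hd j hj.1) hj.2 hw'
        exact Finset.disjoint_left.1 h (Finset.mem_erase.2 ⟨hwv, hw⟩) hw'
    have h1 := (Finset.card_le_card hsub).trans
      (Finset.card_biUnion_le_card_mul _ _ _ hpart)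
    have h2 := hB c hc
    have h3 := Finset.card_erase_add_one hc
    have h4 : 0 < (b + 1) ^ a := by positivity
    calc C.card ≤ (B c).card * (b + 1) ^ a + 1 := by omega
      _ ≤ b * (b + 1) ^ a + (b + 1) ^ a := by gcongr; omega
      _ = (b + 1) ^ (a + 1) := by ring

theorem IsMatching.mono {V : Type*} {r : ℕ} {A B : Finset (Finset V)} (hA : IsMatching r A)
    (h : B ⊆ A) : IsMatching r B :=
  ⟨fun e he => hA.1 e (h he), fun e he f hf => hA.2 e (h he) f (h hf)⟩

theorem IsMatching.sum_card_inter_le {V : Type*} [DecidableEq V] {r : ℕ}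
    {A : Finset (Finset V)} (hA : IsMatching r A) (U : Finset V) :
    ∑ f ∈ A, (f ∩ U).card ≤ U.card := by
  rw [← Finset.card_biUnion]
  · exact Finset.card_le_card (Finset.biUnion_subset.2 fun f _ => Finset.inter_subset_right)
  · exact fun e he f hf hef => (hA.2 e he f hf hef).mono Finset.inter_subset_left
      Finset.inter_subset_left

theorem IsMatching.card_filter_not_disjoint_le {V : Type*} [DecidableEq V] {r : ℕ}
    {A : Finset (Finset V)} (hA : IsMatching r A) (U : Finset V) :
    (A.filter fun f => ¬ Disjoint f U).card ≤ U.card := by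
  refine le_trans ?_ (hA.sum_card_inter_le U)
  rw [Finset.card_filter]
  refine Finset.sum_le_sum fun f _ => ?_
  split_ifs with h
  · exact Nat.zero_le _
  · rw [Finset.disjoint_iff_inter_eq_empty, ← Finset.card_eq_zero] at h
    exact Nat.one_le_iff_ne_zero.2 h

/-- The choice `e` of edges is a rainbow matching using exactly the colours in `I`. -/
def IsRainbowOn {V ι : Type*} (M : ι → Finset (Finset V)) (I : Finset ι)
    (e : ι → Finset V) : Prop :=
  (∀ i ∈ I, e i ∈ M i) ∧ ∀ i ∈ I, ∀ j ∈ I, i ≠ j → Disjoint (e i) (e j)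

theorem IsRainbowOn.card_biUnion_le {V ι : Type*} [DecidableEq V]
    {M : ι → Finset (Finset V)} {r : ℕ} (hM : ∀ i, IsMatching r (M i)) {I : Finset ι}
    {e : ι → Finset V} (h : IsRainbowOn M I e) : (I.biUnion e).card ≤ I.card * r :=
  Finset.card_biUnion_le_card_mul _ _ _ fun i hi => ((hM i).1 _ (h.1 i hi)).le

theorem IsRainbowOn.insert {V ι : Type*} [DecidableEq ι]
    {M : ι → Finset (Finset V)} {I : Finset ι} {e : ι → Finset V} (h : IsRainbowOn M I e)
    {c : ι} (hc : c ∉ I) {f : Finset V} (hf : f ∈ M c) (hfe : ∀ i ∈ I, Disjoint f (e i)) :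
    IsRainbowOn M (insert c I) (Function.update e c f) := by
  have hne : ∀ i ∈ I, i ≠ c := fun i hi hic => hc (hic ▸ hi)
  refine ⟨fun i hi => ?_, fun i hi j hj hij => ?_⟩
  · rcases Finset.mem_insert.1 hi with rfl | hi
    · simpa using hf
    · simpa [Function.update_of_ne (hne i hi)] using h.1 i hi
  · rcases Finset.mem_insert.1 hi with rfl | hi' <;> rcases Finset.mem_insert.1 hj with rfl | hj'
    · exact absurd rfl hij
    · simpa [Function.update_of_ne (hne j hj')] using hfe j hj'
    · simpa [Function.update_of_ne (hne i hi')] using (hfe i hi').symm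
    · simpa [Function.update_of_ne (hne i hi'), Function.update_of_ne (hne j hj')] using
        h.2 i hi' j hj' hij

theorem IsRainbowOn.mono {V ι : Type*} {M : ι → Finset (Finset V)} {I J : Finset ι}
    {e : ι → Finset V} (h : IsRainbowOn M I e) (hJ : J ⊆ I) : IsRainbowOn M J e :=
  ⟨fun i hi => h.1 i (hJ hi), fun i hi j hj => h.2 i (hJ hi) j (hJ hj)⟩

/-- Greedy choice of a rainbow matching. -/
theorem exists_isRainbowOn_of_le_card {V ι : Type*} {r : ℕ} (hr : 0 < r)
    {M : ι → Finset (Finset V)} (hM : ∀ i, IsMatching r (M i)) (J : Finset ι)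
    (hJ : ∀ i ∈ J, J.card * r ≤ (M i).card) : ∃ e, IsRainbowOn M J e := by
  classical
  induction J using Finset.induction_on with
  | empty => exact ⟨fun _ => ∅, by simp [IsRainbowOn]⟩
  | insert c J hc ih =>
    rw [Finset.card_insert_of_notMem hc] at hJ
    obtain ⟨e, he⟩ := ih fun i hi =>
      (Nat.mul_le_mul_right r (Nat.le_succ _)).trans (hJ i (Finset.mem_insert_of_mem hi))
    have h1 := ((hM c).card_filter_not_disjoint_le (J.biUnion e)).trans
      (he.card_biUnion_le hM)
    have h2 := hJ c (Finset.mem_insert_self _ _)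
    have h3 : ∃ f ∈ M c, Disjoint f (J.biUnion e) := by
      by_contra! hcon
      rw [Finset.filter_true_of_mem hcon] at h1
      nlinarith
    obtain ⟨f, hf, hfd⟩ := h3
    exact ⟨_, he.insert hc hf fun i hi =>
      hfd.mono_right (Finset.subset_biUnion_of_mem e hi)⟩

/-- In a collection of large matchings all but few colours can be used by a rainbow matching. -/
theorem exists_isRainbowOn_card_mul_le {V ι : Type*} [Fintype ι] [DecidableEq ι] {r : ℕ}
    {M : ι → Finset (Finset V)} (hM : ∀ i, IsMatching r (M i)) {d : ℝ}
    (hcard : ∀ i, ((r : ℝ) + 1) * Fintype.card ι + d ≤ 2 * ((M i).card : ℝ)) :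
    ∃ I e, IsRainbowOn M I e ∧
      ((Finset.univ \ I).card : ℝ) * d ≤ r * Fintype.card ι * (r + 1 : ℝ) ^ r := by
  classical
  obtain ⟨I, hI, hmax⟩ := Finset.exists_max_image
    (Finset.univ.filter fun I : Finset ι => ∃ e, IsRainbowOn M I e) Finset.card
    ⟨∅, Finset.mem_filter.2 ⟨Finset.mem_univ _, fun _ => ∅, by simp [IsRainbowOn]⟩⟩
  simp only [Finset.mem_filter, Finset.mem_univ, true_and] at hI hmax
  obtain ⟨e, he⟩ := hI
  refine ⟨I, e, he, ?_⟩
  set U := I.biUnion e with hU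
  have hUcard : U.card ≤ I.card * r := he.card_biUnion_le hM
  -- `G c j` consists of the edges of colour `c` meeting the rainbow matching only in `e j`
  set G : ι → ι → Finset (Finset V) := fun c j =>
    (M c).filter fun f => ¬ Disjoint f (e j) ∧ ∀ i ∈ I, i ≠ j → Disjoint f (e i) with hG
  have hGcard : ∀ c, ∀ j ∈ I, (G c j).card ≤ r := by
    intro c j hj
    have h1 : G c j ⊆ (M c).filter fun f => ¬ Disjoint f (e j) :=
      Finset.monotone_filter_right _ fun f _ hf => hf.1
    exact (Finset.card_le_card h1).trans (((hM c).card_filter_not_disjoint_le _).trans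
      ((hM j).1 _ (he.1 j hj)).le)
  have hmiss : ∀ c ∉ I, ∀ f ∈ M c, ¬ Disjoint f U := by
    intro c hc f hf hfU
    have := hmax _ ⟨_, he.insert hc hf fun i hi =>
      hfU.mono_right (Finset.subset_biUnion_of_mem e hi)⟩
    rw [Finset.card_insert_of_notMem hc] at this
    omega
  have hsingle : ∀ c ∉ I, 2 * (M c).card ≤ (∑ j ∈ I, (G c j).card) + I.card * r := by
    intro c hc
    have h1 : ((M c).filter fun f => (f ∩ U).card = 1) ⊆ I.biUnion (G c) := by
      intro f hf
      rw [Finset.mem_filter, Finset.card_eq_one] at hf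
      obtain ⟨hfM, v, hv⟩ := hf
      have hvU : v ∈ f ∧ v ∈ U := Finset.mem_inter.1 (hv ▸ Finset.mem_singleton_self v)
      obtain ⟨j, hj, hvj⟩ := Finset.mem_biUnion.1 hvU.2
      refine Finset.mem_biUnion.2 ⟨j, hj, Finset.mem_filter.2 ⟨hfM, ?_, ?_⟩⟩
      · exact Finset.not_disjoint_iff.2 ⟨v, hvU.1, hvj⟩
      · intro i hi hij
        refine Finset.disjoint_left.2 fun w hw hwi => ?_
        have hwv : w ∈ f ∩ U := Finset.mem_inter.2 ⟨hw, Finset.mem_biUnion.2 ⟨i, hi, hwi⟩⟩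
        rw [hv, Finset.mem_singleton] at hwv
        exact Finset.disjoint_left.1 (he.2 i hi j hj hij) hwi (hwv ▸ hvj)
    have h2 := (Finset.card_le_card h1).trans Finset.card_biUnion_le
    have h3 := ((hM c).sum_card_inter_le U).trans hUcard
    have h4 : ∑ f ∈ M c, 2 ≤
        ∑ f ∈ M c, ((f ∩ U).card + if (f ∩ U).card = 1 then 1 else 0) := by
      refine Finset.sum_le_sum fun f hf => ?_
      have := hmiss c hc f hf
      rw [Finset.disjoint_iff_inter_eq_empty, ← Finset.card_eq_zero] at this
      split_ifs <;> omega
    rw [Finset.sum_add_distrib, ← Finset.card_filter, Finset.sum_const, smul_eq_mul] at h4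
    omega
  -- many edges `e j` can be exchanged for either of two disjoint edges of colour `c`
  have hZ : ∀ c ∉ I, d ≤ r * ((I.filter fun j => 2 ≤ (G c j).card).card : ℝ) := by
    intro c hc
    have h1 : ∑ j ∈ I, (G c j).card ≤
        ∑ j ∈ I, (1 + r * if 2 ≤ (G c j).card then 1 else 0) := by
      refine Finset.sum_le_sum fun j hj => ?_
      have := hGcard c j hj
      split_ifs <;> omega
    rw [Finset.sum_add_distrib, ← Finset.mul_sum, ← Finset.card_filter, Finset.sum_const,
      smul_eq_mul, mul_one] at h1
    have h2 : 2 * (M c).card ≤ I.card * (r + 1) +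
        r * (I.filter fun j => 2 ≤ (G c j).card).card := by
      linarith [hsingle c hc]
    have h3 : I.card * (r + 1) ≤ Fintype.card ι * (r + 1) :=
      Nat.mul_le_mul_right _ (Finset.card_le_univ _)
    have h4 := hcard c
    have h5 : (2 * (M c).card : ℝ) ≤ Fintype.card ι * (r + 1) +
        r * (I.filter fun j => 2 ≤ (G c j).card).card := by
      exact_mod_cast h2.trans (Nat.add_le_add_right h3 _)
    linarith
  have hpair : ∀ j ∈ I, ((Finset.univ \ I).filter fun c => 2 ≤ (G c j).card).card ≤
      (r + 1) ^ r := by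
    intro j hj
    have hex : ∀ c, ∃ p : Finset V × Finset V, 2 ≤ (G c j).card →
        p.1 ∈ G c j ∧ p.2 ∈ G c j ∧ p.1 ≠ p.2 := by
      intro c
      by_cases h : 2 ≤ (G c j).card
      · obtain ⟨a, ha, b, hb, hab⟩ := Finset.one_lt_card.1 h
        exact ⟨(a, b), fun _ => ⟨ha, hb, hab⟩⟩
      · exact ⟨(∅, ∅), fun h' => absurd h' h⟩
    choose p hp using hex
    have hmem : ∀ {c f}, f ∈ G c j → f ∈ M c ∧ ∀ i ∈ I, i ≠ j → Disjoint f (e i) :=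
      fun hf => ⟨(Finset.mem_filter.1 hf).1, (Finset.mem_filter.1 hf).2.2⟩
    refine card_le_of_crossIntersecting r r _ (fun c => (p c).1) (fun c => (p c).2) ?_ ?_ ?_ ?_
    · intro c hc
      exact ((hM c).1 _ (hmem (hp c (Finset.mem_filter.1 hc).2).1).1).le
    · intro c hc
      exact ((hM c).1 _ (hmem (hp c (Finset.mem_filter.1 hc).2).2.1).1).le
    · intro c hc
      obtain ⟨h1, h2, h3⟩ := hp c (Finset.mem_filter.1 hc).2
      exact (hM c).2 _ (hmem h1).1 _ (hmem h2).1 h3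
    · intro c hc c' hc' hcc hdis
      simp only [Finset.mem_filter, Finset.mem_sdiff, Finset.mem_univ, true_and] at hc hc'
      have h1 := hmem (hp c hc.2).1
      have h2 := hmem (hp c' hc'.2).2.1
      have he1 : IsRainbowOn M (I.erase j) e := he.mono (Finset.erase_subset _ _)
      have hc1 : c ∉ I.erase j := fun h => hc.1 (Finset.mem_of_mem_erase h)
      have he2 := he1.insert hc1 h1.1 fun i hi =>
        h1.2 i (Finset.mem_of_mem_erase hi) (Finset.ne_of_mem_erase hi)
      have hc2 : c' ∉ insert c (I.erase j) := by
        rw [Finset.mem_insert, not_or]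
        exact ⟨hcc.symm, fun h => hc'.1 (Finset.mem_of_mem_erase h)⟩
      have he3 := he2.insert hc2 h2.1 (by
        intro i hi
        rcases Finset.mem_insert.1 hi with rfl | hi
        · simpa using hdis.symm
        · have hic : i ≠ c := fun h => hc1 (h ▸ hi)
          simpa [Function.update_of_ne hic] using
            h2.2 i (Finset.mem_of_mem_erase hi) (Finset.ne_of_mem_erase hi))
      have := hmax _ ⟨_, he3⟩
      rw [Finset.card_insert_of_notMem hc2, Finset.card_insert_of_notMem hc1] at this
      have := Finset.card_erase_add_one hj
      omega
  have hdouble : ∑ c ∈ Finset.univ \ I, (I.filter fun j => 2 ≤ (G c j).card).card =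
      ∑ j ∈ I, ((Finset.univ \ I).filter fun c => 2 ≤ (G c j).card).card :=
    Finset.sum_card_bipartiteAbove_eq_sum_card_bipartiteBelow fun c j => 2 ≤ (G c j).card
  have hle : ∑ c ∈ Finset.univ \ I, (I.filter fun j => 2 ≤ (G c j).card).card ≤
      Fintype.card ι * (r + 1) ^ r := by
    rw [hdouble]
    calc _ ≤ I.card * (r + 1) ^ r := Finset.sum_le_card_nsmul _ _ _ hpair
      _ ≤ _ := Nat.mul_le_mul_right _ (Finset.card_le_univ _)
  calc ((Finset.univ \ I).card : ℝ) * d = ∑ c ∈ Finset.univ \ I, d := by simp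
    _ ≤ ∑ c ∈ Finset.univ \ I, r * ((I.filter fun j => 2 ≤ (G c j).card).card : ℝ) :=
      Finset.sum_le_sum fun c hc => hZ c (Finset.mem_sdiff.1 hc).2
    _ = r * ((∑ c ∈ Finset.univ \ I, (I.filter fun j => 2 ≤ (G c j).card).card : ℕ) : ℝ) := by
      rw [← Finset.mul_sum]; push_cast; rfl
    _ ≤ r * ((Fintype.card ι * (r + 1) ^ r : ℕ) : ℝ) := by gcongr
    _ = _ := by push_cast; ring

section Sampling

open MeasureTheory ProbabilityTheory

variable {V : Type*} {ν : Measure Bool} [IsProbabilityMeasure ν]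

theorem integrable_infinitePi_of_dependsOn {S : Finset V} {F : (V → Bool) → ℝ}
    (hF : DependsOn F S) : Integrable F (Measure.infinitePi fun _ : V => ν) := by
  obtain ⟨g, rfl⟩ := dependsOn_iff_exists_comp.1 hF
  have hg : Integrable g ((Measure.infinitePi fun _ : V => ν).map S.restrict) :=
    haveI := Measure.isProbabilityMeasure_map (μ := Measure.infinitePi fun _ : V => ν)
      (Finset.measurable_restrict S).aemeasurable
    Integrable.of_finite
  exact hg.comp_measurable (Finset.measurable_restrict S)

theorem integral_infinitePi_mul_of_dependsOn {S T : Finset V} (hST : Disjoint S T)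
    {F G : (V → Bool) → ℝ} (hF : DependsOn F S) (hG : DependsOn G T) :
    ∫ ω, F ω * G ω ∂(Measure.infinitePi fun _ : V => ν) =
      (∫ ω, F ω ∂(Measure.infinitePi fun _ : V => ν)) *
        ∫ ω, G ω ∂(Measure.infinitePi fun _ : V => ν) := by
  have hFi := integrable_infinitePi_of_dependsOn (ν := ν) hF
  have hGi := integrable_infinitePi_of_dependsOn (ν := ν) hG
  obtain ⟨f, rfl⟩ := dependsOn_iff_exists_comp.1 hF
  obtain ⟨g, rfl⟩ := dependsOn_iff_exists_comp.1 hG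
  have hind : iIndepFun (fun (v : V) (ω : V → Bool) => ω v)
      (Measure.infinitePi fun _ : V => ν) :=
    iIndepFun_infinitePi (X := fun _ x => x) fun _ => measurable_id
  have h := (hind.indepFun_finset S T hST fun v => measurable_pi_apply v).comp
    (measurable_of_finite f) (measurable_of_finite g)
  exact h.integral_fun_mul_eq_mul_integral hFi.aestronglyMeasurable hGi.aestronglyMeasurable

theorem dependsOn_prod_biUnion [DecidableEq V] (A : Finset (Finset V))
    (g : Finset V → (V → Bool) → ℝ) (hg : ∀ e, DependsOn (g e) e) :
    DependsOn (fun ω => ∏ e ∈ A, g e ω) (A.biUnion id : Finset V) := by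
  intro ω ω' h
  refine Finset.prod_congr rfl fun e he => hg e fun v hv => h v ?_
  exact Finset.mem_biUnion.2 ⟨e, he, hv⟩

theorem integral_infinitePi_prod_of_dependsOn (A : Finset (Finset V))
    (hA : ∀ e ∈ A, ∀ f ∈ A, e ≠ f → Disjoint e f)
    (g : Finset V → (V → Bool) → ℝ) (hg : ∀ e, DependsOn (g e) e) :
    ∫ ω, ∏ e ∈ A, g e ω ∂(Measure.infinitePi fun _ : V => ν) =
      ∏ e ∈ A, ∫ ω, g e ω ∂(Measure.infinitePi fun _ : V => ν) := by
  classical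
  induction A using Finset.induction_on with
  | empty => simp
  | insert e A he ih =>
    simp only [Finset.prod_insert he]
    rw [integral_infinitePi_mul_of_dependsOn (T := A.biUnion id) _ (hg e)
      (dependsOn_prod_biUnion A g hg), ih]
    · exact fun e he f hf =>
        hA e (Finset.mem_insert_of_mem he) f (Finset.mem_insert_of_mem hf)
    · refine (Finset.disjoint_biUnion_right _ _ _).2 fun f hf => ?_
      exact hA e (Finset.mem_insert_self _ _) f (Finset.mem_insert_of_mem hf)
        fun h => he (h ▸ hf)

open scoped Classical in
theorem integral_infinitePi_forall_mem (e : Finset V) :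
    ∫ ω, (if ∀ v ∈ e, ω v = true then (1 : ℝ) else 0) ∂(Measure.infinitePi fun _ : V => ν) =
      ν.real {true} ^ e.card := by
  have h : (fun ω : V → Bool => if ∀ v ∈ e, ω v = true then (1 : ℝ) else 0) =
      (Set.pi (e : Set V) fun _ => ({true} : Set Bool)).indicator 1 := by
    ext ω
    simp [Set.indicator_apply, Set.mem_pi]
  rw [h, integral_indicator_one
    (MeasurableSet.pi e.countable_toSet fun _ _ => measurableSet_singleton _),
    measureReal_def, Measure.infinitePi_pi _ fun _ _ => measurableSet_singleton _]
  simp [measureReal_def]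

open scoped Classical in
theorem integral_infinitePi_exists_mem_le (e : Finset V) :
    ∫ ω, (if ∃ v ∈ e, ω v = true then (1 : ℝ) else 0) ∂(Measure.infinitePi fun _ : V => ν) ≤
      e.card * ν.real {true} := by
  have hdep : ∀ v : V, DependsOn (fun ω : V → Bool => if ∀ w ∈ ({v} : Finset V), ω w = true
      then (1 : ℝ) else 0) ({v} : Finset V) := by
    intro v ω ω' h
    have := h v (by simp)
    simp [this]
  calc _ ≤ ∫ ω, ∑ v ∈ e, (if ∀ w ∈ ({v} : Finset V), ω w = true then (1 : ℝ) else 0)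
        ∂(Measure.infinitePi fun _ : V => ν) := by
        refine integral_mono (integrable_infinitePi_of_dependsOn (S := e) ?_)
          (integrable_finsetSum _ fun v _ => integrable_infinitePi_of_dependsOn (hdep v)) ?_
        · intro ω ω' h
          have : (∃ v ∈ e, ω v = true) ↔ ∃ v ∈ e, ω' v = true :=
            exists_congr fun v => and_congr_right fun hv => by rw [h v hv]
          simp only [this]
        · intro ω
          dsimp only
          split_ifs with h
          · obtain ⟨v, hv, hvω⟩ := h
            refine le_trans ?_ (Finset.single_le_sum (fun w _ => ?_) hv)
            · simp [hvω]
            · split_ifs <;> norm_num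
          · exact Finset.sum_nonneg fun w _ => by split_ifs <;> norm_num
    _ = e.card * ν.real {true} := by
        rw [integral_finsetSum _ fun v _ => integrable_infinitePi_of_dependsOn (hdep v)]
        simp only [integral_infinitePi_forall_mem]
        simp

open scoped Classical in
theorem integral_exp_card_meeting_le {r : ℕ} {A : Finset (Finset V)} (hA : IsMatching r A) :
    ∫ ω, Real.exp ((A.filter fun e => ∃ v ∈ e, ω v = true).card : ℝ)
        ∂(Measure.infinitePi fun _ : V => ν) ≤ Real.exp (2 * (r * ν.real {true}) * A.card) := by
  have hdep : ∀ e : Finset V, DependsOn (fun ω : V → Bool => if ∃ v ∈ e, ω v = true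
      then (1 : ℝ) else 0) e := by
    intro e ω ω' h
    have : (∃ v ∈ e, ω v = true) ↔ ∃ v ∈ e, ω' v = true :=
      exists_congr fun v => and_congr_right fun hv => by rw [h v hv]
    simp only [this]
  have hprod : ∀ ω : V → Bool, Real.exp ((A.filter fun e => ∃ v ∈ e, ω v = true).card : ℝ) =
      ∏ e ∈ A, (1 + (Real.exp 1 - 1) * if ∃ v ∈ e, ω v = true then (1 : ℝ) else 0) := by
    intro ω
    rw [Finset.card_filter, Nat.cast_sum, Real.exp_sum]
    refine Finset.prod_congr rfl fun e _ => ?_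
    split_ifs <;> simp
  simp only [hprod]
  rw [integral_infinitePi_prod_of_dependsOn A hA.2 _ fun e ω ω' h => by
    simp only [hdep e h], mul_comm _ (A.card : ℝ), Real.exp_nat_mul, ← Finset.prod_const]
  have he : (0 : ℝ) ≤ Real.exp 1 - 1 := by linarith [Real.add_one_le_exp (1 : ℝ)]
  refine Finset.prod_le_prod (fun e _ => integral_nonneg fun ω => ?_) fun e he' => ?_
  · dsimp only
    split_ifs <;> simp [Real.exp_nonneg]
  · rw [integral_add (integrable_const _)
      ((integrable_infinitePi_of_dependsOn (hdep e)).const_mul _), integral_const_mul]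
    have h1 := integral_infinitePi_exists_mem_le (ν := ν) e
    rw [hA.1 e he'] at h1
    have h2 : Real.exp 1 - 1 ≤ 2 := by linarith [Real.exp_one_lt_d9]
    have h3 : (0 : ℝ) ≤ r * ν.real {true} := by positivity
    have h4 := Real.add_one_le_exp (2 * (r * ν.real {true}))
    have h5 := mul_le_mul_of_nonneg_left h1 he
    have h6 := mul_le_mul_of_nonneg_right h2 h3
    simp only [integral_const, probReal_univ, smul_eq_mul, mul_one]
    linarith

open scoped Classical in
theorem integral_exp_neg_card_contained_le {r : ℕ} {A : Finset (Finset V)}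
    (hA : IsMatching r A) :
    ∫ ω, Real.exp (-((A.filter fun e => ∀ v ∈ e, ω v = true).card : ℝ))
        ∂(Measure.infinitePi fun _ : V => ν) ≤
      Real.exp (-(ν.real {true} ^ r / 2) * A.card) := by
  have hdep : ∀ e : Finset V, DependsOn (fun ω : V → Bool => if ∀ v ∈ e, ω v = true
      then (1 : ℝ) else 0) e := by
    intro e ω ω' h
    have : (∀ v ∈ e, ω v = true) ↔ ∀ v ∈ e, ω' v = true :=
      forall₂_congr fun v hv => by rw [h v hv]
    simp only [this]
  have hprod : ∀ ω : V → Bool, Real.exp (-((A.filter fun e => ∀ v ∈ e, ω v = true).card : ℝ)) =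
      ∏ e ∈ A, (1 + (Real.exp (-1) - 1) * if ∀ v ∈ e, ω v = true then (1 : ℝ) else 0) := by
    intro ω
    rw [Finset.card_filter, Nat.cast_sum, ← Finset.sum_neg_distrib, Real.exp_sum]
    refine Finset.prod_congr rfl fun e _ => ?_
    split_ifs <;> simp
  simp only [hprod]
  rw [integral_infinitePi_prod_of_dependsOn A hA.2 _ fun e ω ω' h => by
    simp only [hdep e h], mul_comm _ (A.card : ℝ), Real.exp_nat_mul, ← Finset.prod_const]
  refine Finset.prod_le_prod (fun e _ => integral_nonneg fun ω => ?_) fun e he' => ?_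
  · dsimp only
    split_ifs <;> simp [Real.exp_nonneg]
  · rw [integral_add (integrable_const _)
      ((integrable_infinitePi_of_dependsOn (hdep e)).const_mul _), integral_const_mul,
      integral_infinitePi_forall_mem, hA.1 e he']
    have h2 : Real.exp (-1) - 1 ≤ -(1 / 2) := by linarith [Real.exp_neg_one_lt_d9]
    have h3 : (0 : ℝ) ≤ ν.real {true} ^ r := by positivity
    have h4 := Real.add_one_le_exp (-(ν.real {true} ^ r / 2))
    have h6 := mul_le_mul_of_nonneg_right h2 h3
    simp only [integral_const, probReal_univ, smul_eq_mul, mul_one]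
    linarith

open scoped Classical in
/-- A random set of vertices meets few edges of each matching while containing many. -/
theorem exists_vertex_sample {V ι : Type*} [Fintype ι] {r : ℕ} {M : ι → Finset (Finset V)}
    (hM : ∀ i, IsMatching r (M i)) {p T K : ℝ} (hp₀ : 0 ≤ p) (hp₁ : p ≤ 1)
    (h : ∑ i, (Real.exp (2 * (r * p) * (M i).card) * Real.exp (-T) +
      Real.exp (-(p ^ r / 2) * (M i).card) * Real.exp K) < 1) :
    ∃ S : Set V, ∀ i, (((M i).filter fun e => ∃ v ∈ e, v ∈ S).card : ℝ) ≤ T ∧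
      K ≤ ((M i).filter fun e => ∀ v ∈ e, v ∈ S).card := by
  set ν : Measure Bool := bernoulliMeasure true false ⟨p, hp₀, hp₁⟩ with hν
  have hνp : ν.real {true} = p := by
    rw [hν, bernoulliMeasure_real_apply _ (measurableSet_singleton _)]
    simp
  set μ := Measure.infinitePi fun _ : V => ν with hμ
  have hint₁ : ∀ i, Integrable (fun ω : V → Bool =>
      Real.exp (((M i).filter fun e => ∃ v ∈ e, ω v = true).card : ℝ)) μ := by
    intro i
    refine integrable_infinitePi_of_dependsOn (S := (M i).biUnion id) fun ω ω' h => ?_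
    have : ∀ e ∈ M i, (∃ v ∈ e, ω v = true) ↔ ∃ v ∈ e, ω' v = true := fun e he =>
      exists_congr fun v => and_congr_right fun hv => by
        rw [h v (Finset.mem_biUnion.2 ⟨e, he, hv⟩)]
    rw [Finset.filter_congr this]
  have hint₂ : ∀ i, Integrable (fun ω : V → Bool =>
      Real.exp (-(((M i).filter fun e => ∀ v ∈ e, ω v = true).card : ℝ))) μ := by
    intro i
    refine integrable_infinitePi_of_dependsOn (S := (M i).biUnion id) fun ω ω' h => ?_
    have : ∀ e ∈ M i, (∀ v ∈ e, ω v = true) ↔ ∀ v ∈ e, ω' v = true := fun e he =>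
      forall₂_congr fun v hv => by rw [h v (Finset.mem_biUnion.2 ⟨e, he, hv⟩)]
    rw [Finset.filter_congr this]
  by_contra! hcon
  have hbad : ∀ ω : V → Bool, 1 ≤ ∑ i,
      (Real.exp (((M i).filter fun e => ∃ v ∈ e, ω v = true).card : ℝ) * Real.exp (-T) +
        Real.exp (-(((M i).filter fun e => ∀ v ∈ e, ω v = true).card : ℝ)) * Real.exp K) := by
    intro ω
    obtain ⟨i, hi⟩ := hcon {v | ω v = true}
    simp only [Set.mem_ofPred_eq] at hi
    refine le_trans ?_ (Finset.single_le_sum (fun j _ => by positivity) (Finset.mem_univ i))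
    rw [← Real.exp_add, ← Real.exp_add]
    by_cases hT : (((M i).filter fun e => ∃ v ∈ e, ω v = true).card : ℝ) ≤ T
    · have := hi hT
      have h1 := Real.one_le_exp (x := -(((M i).filter fun e => ∀ v ∈ e, ω v = true).card : ℝ) + K)
        (by linarith)
      have h2 := Real.exp_nonneg
        ((((M i).filter fun e => ∃ v ∈ e, ω v = true).card : ℝ) + -T)
      linarith
    · have h1 := Real.one_le_exp
        (x := (((M i).filter fun e => ∃ v ∈ e, ω v = true).card : ℝ) + -T) (by linarith)
      have h2 := Real.exp_nonneg
        (-(((M i).filter fun e => ∀ v ∈ e, ω v = true).card : ℝ) + K)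
      linarith
  have h1 := integral_mono (μ := μ) (integrable_const 1)
    (integrable_finsetSum Finset.univ fun i _ =>
      ((hint₁ i).mul_const (Real.exp (-T))).add ((hint₂ i).mul_const (Real.exp K))) hbad
  rw [integral_finsetSum _ fun i _ =>
      ((hint₁ i).mul_const (Real.exp (-T))).add ((hint₂ i).mul_const (Real.exp K))] at h1
  simp only [integral_const, probReal_univ, smul_eq_mul, mul_one] at h1
  refine absurd (h1.trans (Finset.sum_le_sum fun i _ => ?_)) (not_le.2 h)
  rw [integral_add' ((hint₁ i).mul_const _) ((hint₂ i).mul_const _), integral_mul_const,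
    integral_mul_const]
  have h2 := integral_exp_card_meeting_le (ν := ν) (hM i)
  have h3 := integral_exp_neg_card_contained_le (ν := ν) (hM i)
  rw [hνp] at h2 h3
  gcongr

end Sampling

theorem exists_isRainbowOn_univ {V : Type*} {r n s : ℕ} (hr : 3 ≤ r) {x : ℝ} (hx : 1 ≤ x)
    (hxn : x ^ (2 * r) = n) (hx₁ : 2 * (x ^ (2 * r) * Real.exp (-x)) < 1)
    (hx₂ : 2 ^ r * (r * (r + 1 : ℝ) ^ r + 1) ≤ x)
    {M : Fin n → Finset (Finset V)} (hM : ∀ i, IsMatching r (M i)) (hs : ∀ i, (M i).card = s)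
    (hs₁ : ((r : ℝ) + 1) * n / 2 + 3 * (r : ℝ) ^ 2 * (n / x) ≤ s) (hs₂ : (s : ℝ) ≤ r * n) :
    ∃ e, IsRainbowOn M Finset.univ e := by
  classical
  have hx0 : 0 < x := by linarith
  have hr' : (3 : ℝ) ≤ r := by exact_mod_cast hr
  have hnpos : (0 : ℝ) < n := hxn ▸ by positivity
  set B : ℝ := (r + 1 : ℝ) ^ r with hB
  have hBpos : 0 < B := by positivity
  have hnx : x ≤ n / x := by
    rw [le_div_iff₀ hx0, ← hxn, ← pow_two]
    exact pow_le_pow_right₀ hx (by omega)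
  have hnx0 : 0 < (n : ℝ) / x := by positivity
  have hmeet : Real.exp (2 * (r * (1 / (2 * x))) * s) * Real.exp (-(2 * r ^ 2 * (n / x))) ≤
      Real.exp (-x) := by
    rw [← Real.exp_add, Real.exp_le_exp]
    have h1 : 2 * (r * (1 / (2 * x))) * s ≤ (r : ℝ) ^ 2 * (n / x) := by
      calc 2 * (r * (1 / (2 * x))) * (s : ℝ) ≤ 2 * (r * (1 / (2 * x))) * (r * n) := by gcongr
        _ = (r : ℝ) ^ 2 * (n / x) := by field_simp
    have h2 : 1 * ((n : ℝ) / x) ≤ (r : ℝ) ^ 2 * (n / x) := by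
      gcongr
      nlinarith
    linarith
  have hcontain : Real.exp (-((1 / (2 * x)) ^ r / 2) * s) * Real.exp (r * B * x) ≤
      Real.exp (-x) := by
    rw [← Real.exp_add, Real.exp_le_exp]
    have h1 : 2 * (n : ℝ) ≤ s := by
      have : 0 ≤ 3 * (r : ℝ) ^ 2 * (n / x) := by positivity
      nlinarith
    have h2 : (r * B + 1) * x ≤ x ^ r / 2 ^ r := by
      rw [le_div_iff₀ (by positivity)]
      calc (r * B + 1) * x * 2 ^ r = (2 ^ r * (r * B + 1)) * x := by ring
        _ ≤ x * x := by gcongr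
        _ = x ^ 2 := by ring
        _ ≤ x ^ r := pow_le_pow_right₀ hx (by omega)
    have h3 : x ^ r / 2 ^ r ≤ (1 / (2 * x)) ^ r / 2 * s := by
      calc x ^ r / 2 ^ r = (1 / (2 * x)) ^ r / 2 * (2 * x ^ (2 * r)) := by
            rw [two_mul r, pow_add, div_pow, mul_pow]
            field_simp
            simp
        _ ≤ _ := by rw [hxn]; gcongr
    linarith
  obtain ⟨S, hS⟩ := exists_vertex_sample hM (p := 1 / (2 * x)) (T := 2 * r ^ 2 * (n / x))
    (K := r * B * x) (by positivity) (by rw [div_le_one (by positivity)]; linarith) (by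
      calc _ ≤ ∑ _i : Fin n, (Real.exp (-x) + Real.exp (-x)) := by
            refine Finset.sum_le_sum fun i _ => ?_
            rw [hs i]
            exact add_le_add hmeet hcontain
        _ = 2 * (x ^ (2 * r) * Real.exp (-x)) := by
            rw [hxn, Finset.sum_const, Finset.card_univ, Fintype.card_fin, nsmul_eq_mul]
            ring
        _ < 1 := hx₁)
  have hM₁ : ∀ i, IsMatching r ((M i).filter fun e => ¬ ∃ v ∈ e, v ∈ S) := fun i =>
    (hM i).mono (Finset.filter_subset _ _)
  have hM₂ : ∀ i, IsMatching r ((M i).filter fun e => ∀ v ∈ e, v ∈ S) := fun i =>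
    (hM i).mono (Finset.filter_subset _ _)
  obtain ⟨I, e, he, hI⟩ := exists_isRainbowOn_card_mul_le hM₁ (d := 2 * r ^ 2 * (n / x)) (by
    intro i
    have h1 := Finset.card_filter_add_card_filter_not (s := M i) fun e => ∃ v ∈ e, v ∈ S
    have h2 : (((M i).filter fun e => ∃ v ∈ e, v ∈ S).card : ℝ) +
        ((M i).filter fun e => ¬ ∃ v ∈ e, v ∈ S).card = s := by
      rw [← hs i]
      exact_mod_cast h1
    have h3 := (hS i).1
    rw [Fintype.card_fin]
    linarith)
  rw [Fintype.card_fin] at hI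
  have hk : ((Finset.univ \ I).card : ℝ) * r ≤ r * B * x := by
    have h1 : ((Finset.univ \ I).card : ℝ) * (2 * r) ≤ B * x := by
      refine le_of_mul_le_mul_right ?_ (show 0 < r * (n / x) by positivity)
      calc _ = ((Finset.univ \ I).card : ℝ) * (2 * r ^ 2 * (n / x)) := by ring
        _ ≤ r * n * B := hI
        _ = _ := by field_simp
    have h2 : 0 ≤ ((Finset.univ \ I).card : ℝ) * r := by positivity
    have h3 : 0 ≤ B * x := by positivity
    nlinarith
  obtain ⟨e', he'⟩ := exists_isRainbowOn_of_le_card (by omega) hM₂ (Finset.univ \ I)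
    fun i _ => by exact_mod_cast hk.trans (hS i).2
  have hcross : ∀ i ∈ I, ∀ j ∉ I, Disjoint (e i) (e' j) := by
    intro i hi j hj
    have h1 := (Finset.mem_filter.1 (he.1 i hi)).2
    have h2 := (Finset.mem_filter.1 (he'.1 j (by simpa using hj))).2
    exact Finset.disjoint_left.2 fun v hv hv' => h1 ⟨v, hv, h2 v hv'⟩
  refine ⟨fun i => if i ∈ I then e i else e' i, fun i _ => ?_, fun i _ j _ hij => ?_⟩
  · dsimp only
    split_ifs with hi
    · exact (Finset.mem_filter.1 (he.1 i hi)).1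
    · exact (Finset.mem_filter.1 (he'.1 i (by simpa using hi))).1
  · dsimp only
    split_ifs with hi hj hj
    · exact he.2 i hi j hj hij
    · exact hcross i hi j hj
    · exact (hcross j hj i hi).symm
    · exact he'.2 i (by simpa using hi) j (by simpa using hj) hij

/-- Theorem 2.10 (upper bound on h'(r,n)): for r ≥ 3 and all sufficiently large n, any
n matchings of size at least (r+1)n/2 + 3r²n^((2r-1)/(2r)) in an r-uniform hypergraph
admit a rainbow matching of size n. -/
theorem stmt8 (r : ℕ) (hr : 3 ≤ r) :
    ∃ N₀ : ℕ, ∀ n : ℕ, N₀ ≤ n →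
      ∀ (V : Type) (M : Fin n → Finset (Finset V)),
        (∀ i, IsMatching r (M i) ∧
          ((r : ℝ) + 1) * n / 2 + 3 * (r : ℝ) ^ 2 *
              (n : ℝ) ^ ((2 * (r : ℝ) - 1) / (2 * (r : ℝ))) ≤ ((M i).card : ℝ)) →
        HasRainbow M n := by
  have hr0 : (0 : ℝ) < r := by positivity
  have hroot : Filter.Tendsto (fun n : ℕ => (n : ℝ) ^ (1 / (2 * (r : ℝ)))) Filter.atTop
      Filter.atTop :=
    (tendsto_rpow_atTop (by positivity)).comp tendsto_natCast_atTop_atTop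
  have hexp : ∀ᶠ x : ℝ in Filter.atTop, 2 * (x ^ (2 * r) * Real.exp (-x)) < 1 := by
    have h := (Real.tendsto_pow_mul_exp_neg_atTop_nhds_zero (2 * r)).const_mul 2
    rw [mul_zero] at h
    exact h.eventually_lt_const one_pos
  have hev := hroot.eventually (hexp.and ((Filter.eventually_ge_atTop 2).and
    ((Filter.eventually_ge_atTop (6 * (r : ℝ) ^ 2)).and
      (Filter.eventually_ge_atTop (2 ^ r * (r * (r + 1 : ℝ) ^ r + 1))))))
  obtain ⟨N₀, hN₀⟩ := Filter.eventually_atTop.1 hev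
  refine ⟨N₀, fun n hn V M hM => ?_⟩
  obtain ⟨hx₁, hx2, hx6, hx₂⟩ := hN₀ n hn
  set x : ℝ := (n : ℝ) ^ (1 / (2 * (r : ℝ))) with hx
  have hx0 : 0 < x := by linarith
  have hxn : x ^ (2 * r) = n := by
    rw [hx, ← Real.rpow_natCast, ← Real.rpow_mul (Nat.cast_nonneg n)]
    push_cast
    rw [one_div_mul_cancel (by positivity), Real.rpow_one]
  have hn0 : (0 : ℝ) < n := hxn ▸ by positivity
  have hpow : (n : ℝ) ^ ((2 * (r : ℝ) - 1) / (2 * (r : ℝ))) = n / x := by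
    rw [sub_div, div_self (by positivity), Real.rpow_sub hn0, Real.rpow_one]
  rw [hpow] at hM
  set t : ℝ := ((r : ℝ) + 1) * n / 2 + 3 * (r : ℝ) ^ 2 * (n / x) with ht
  have hsub : ∀ i, ∃ A ⊆ M i, A.card = ⌈t⌉₊ := fun i =>
    Finset.exists_subset_card_eq (Nat.ceil_le.2 (hM i).2)
  choose A hAM hAcard using hsub
  have hceil : (⌈t⌉₊ : ℝ) ≤ r * n := by
    have h1 : (⌈t⌉₊ : ℝ) < t + 1 := Nat.ceil_lt_add_one (by positivity)
    have h2 : 3 * (r : ℝ) ^ 2 * (n / x) ≤ n / 2 := by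
      rw [mul_div_assoc', div_le_iff₀ hx0]
      nlinarith
    have h3 : (2 : ℝ) ≤ n := by
      rw [← hxn]
      exact hx2.trans (le_self_pow₀ (by linarith) (by omega))
    have h4 : (3 : ℝ) ≤ r := by exact_mod_cast hr
    nlinarith
  obtain ⟨e, he⟩ := exists_isRainbowOn_univ hr (by linarith) hxn hx₁ hx₂
    (fun i => (hM i).1.mono (hAM i)) hAcard (Nat.le_ceil t) hceil
  exact ⟨id, e, Function.injective_id, fun j => hAM j (he.1 j (Finset.mem_univ j)),
    fun j k hjk => he.2 j (Finset.mem_univ j) k (Finset.mem_univ k) hjk⟩
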